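/- arXiv:2603.14795 — 2 statements merged into one kernel-verified Lean document; each statement's English description precedes it below -/
import Mathlib

section
/- Let N ≥ 2 be an integer and k ≥ 1 an odd integer, and let B_{k,N} be the N⁻×N⁻ matrix with (i,j)-entry B̃_k(ij/N) for 1 ≤ i,j ≤ N⁻ (with the convention B̃_1 = 0 at integers when k = 1). Then det(B_{k,N}) = (−1)^{N⁻(N⁻−1)/2} · N^{N⁻/2} · ∏_{d | N, d > 2} ∏_{χ odd mod d} ( (−1)^{(k+1)/2}·k!/(2π)^k · L(k,χ) ), where the inner product runs over all Dirichlet characters χ modulo d with χ(−1) = −1. -/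
open scoped Classical in
/-- The periodic Bernoulli function `B̃_k(x) = B_k({x})`, with the convention
`B̃_1(x) = 0` for integer `x`. -/
noncomputable def periodicBernoulli (k : ℕ) (x : ℝ) : ℝ :=
  if k = 1 ∧ Int.fract x = 0 then 0
  else Polynomial.aeval (Int.fract x) (Polynomial.bernoulli k)

/-- For odd `k`, the Bernoulli matrix `B_{k,N} = (B̃_k(ij/N))_{1 ≤ i,j ≤ N⁻}`,
where `N⁻ = ⌊(N−1)/2⌋`. -/
noncomputable def bernoulliMatrixOdd (k N : ℕ) :
    Matrix (Fin ((N - 1) / 2)) (Fin ((N - 1) / 2)) ℝ :=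
  Matrix.of fun i j =>
    periodicBernoulli k ((((i : ℕ) + 1) * ((j : ℕ) + 1) : ℕ) / (N : ℝ))

open scoped Classical in
/-- `∏_{χ odd mod n} ((−1)^{(k+1)/2}·k!/(2π)^k · L(k,χ))`, the product running over all
Dirichlet characters `χ` mod `n` with `χ(−1) = −1`.
(The value for `n = 0` is irrelevant and set to `1`.) -/
noncomputable def oddCharLProd (k : ℕ) : ℕ → ℂ
  | 0 => 1
  | (n + 1) =>
      ∏ χ : DirichletCharacter ℂ (n + 1),
        if χ (-1) = -1 then
          ((-1 : ℂ) ^ ((k + 1) / 2) * (Nat.factorial k) / (2 * Real.pi) ^ k) *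
            DirichletCharacter.LFunction χ k
        else 1

section SinZeta

open Complex HurwitzZeta Filter Topology Set Asymptotics MeasureTheory

theorem exists_norm_geometricKernel_le {z : ℂ} (hz : ‖z‖ = 1) (hz1 : z ≠ 1) :
    ∃ C : ℝ, ∀ t : ℝ, 0 ≤ t → (1 - z * Real.exp (-t)) ∈ slitPlane ∧
      ‖z * Real.exp (-t) / (1 - z * Real.exp (-t))‖ ≤ C * Real.exp (-1 * t) := by
  have hre : z.re < 1 := by
    refine lt_of_le_of_ne (hz ▸ re_le_norm z) fun h => hz1 ?_
    have h2 := sq_norm_sub_sq_re z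
    rw [hz, h] at h2
    have him : z.im = 0 := by nlinarith
    exact Complex.ext (by simpa using h) (by simpa using him)
  have hδ : 0 < 1 - max z.re 0 := by
    have : max z.re 0 < 1 := max_lt hre one_pos
    linarith
  refine ⟨(1 - max z.re 0)⁻¹, fun t ht => ?_⟩
  have he : Real.exp (-t) ≤ 1 := Real.exp_le_one_iff.2 (by linarith)
  have he0 := Real.exp_pos (-t)
  have hle : 1 - max z.re 0 ≤ (1 - z * Real.exp (-t)).re := by
    have : (1 - z * Real.exp (-t)).re = 1 - z.re * Real.exp (-t) := by
      simp [Complex.mul_re, -Complex.ofReal_exp]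
    rw [this]
    have h1 : z.re * Real.exp (-t) ≤ max z.re 0 * Real.exp (-t) :=
      mul_le_mul_of_nonneg_right (le_max_left _ _) he0.le
    have h2 : max z.re 0 * Real.exp (-t) ≤ max z.re 0 :=
      mul_le_of_le_one_right (le_max_right _ _) he
    linarith
  refine ⟨Or.inl (hδ.trans_le hle), ?_⟩
  rw [norm_div, norm_mul, hz, one_mul, norm_real, Real.norm_of_nonneg he0.le, neg_one_mul,
    div_eq_inv_mul]
  gcongr
  exact hle.trans (re_le_norm _)

theorem expZeta_one {x : ℝ} (hx : x ∈ Ioo (0 : ℝ) 1) :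
    expZeta x 1 = -log (1 - cexp (2 * Real.pi * I * x)) := by
  set z := cexp (2 * Real.pi * I * x) with hzdef
  have hz : ‖z‖ = 1 := by
    rw [hzdef, show 2 * Real.pi * I * x = ((2 * Real.pi * x : ℝ) : ℂ) * I by push_cast; ring]
    exact norm_exp_ofReal_mul_I _
  have hz1 : z ≠ 1 := by
    intro h
    obtain ⟨n, hn⟩ := Complex.exp_eq_one_iff.1 h
    have h2 : (2 * Real.pi * I : ℂ) ≠ 0 := two_pi_I_ne_zero
    have h3 : (x : ℂ) = n := by
      rw [mul_comm (n : ℂ)] at hn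
      exact mul_left_cancel₀ h2 hn
    have h4 : x = n := by exact_mod_cast h3
    rw [h4] at hx
    have h5 : (0 : ℤ) < n := by exact_mod_cast hx.1
    have h6 : n < (1 : ℤ) := by exact_mod_cast hx.2
    omega
  have hx0 : (x : UnitAddCircle) ≠ 0 := by
    intro h
    rw [AddCircle.coe_eq_zero_iff] at h
    obtain ⟨n, hn⟩ := h
    have h4 : (n : ℝ) = x := by simpa using hn
    rw [← h4] at hx
    have h5 : (0 : ℤ) < n := by exact_mod_cast hx.1
    have h6 : n < (1 : ℤ) := by exact_mod_cast hx.2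
    omega
  obtain ⟨C, hC⟩ := exists_norm_geometricKernel_le hz hz1
  set F : ℝ → ℂ := fun t => z * Real.exp (-t) / (1 - z * Real.exp (-t)) with hF
  have hcont : ContinuousOn F (Ici 0) := by
    refine ContinuousOn.div (by fun_prop) (by fun_prop) fun t ht => ?_
    exact slitPlane_ne_zero (hC t ht).1
  have hmel : ∀ s : ℂ, 1 < s.re → mellin F s = Complex.Gamma s * expZeta x s := by
    intro s hs
    have hs0 : s ≠ 0 := by rintro rfl; simp at hs; linarith
    have h1 := hasSum_mellin (a := fun n : ℕ => z ^ (n + 1)) (p := fun n : ℕ => (n + 1 : ℝ))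
      (F := F) (s := s) (fun i => Or.inr (by positivity)) (by linarith) ?_ ?_
    · have h2 := (hasSum_nat_add_iff' 1).2 ((hasSum_expZeta_of_one_lt_re x hs).mul_left
        (Complex.Gamma s))
      simp only [Finset.range_one, Finset.sum_singleton, Nat.cast_zero, mul_zero,
        zero_cpow hs0, div_zero, sub_zero] at h2
      refine h1.unique (h2.congr_fun fun n => ?_)
      rw [hzdef, ← Complex.exp_nat_mul, mul_div_assoc]
      push_cast
      ring_nf
    · intro t ht
      have hr : ‖z * Real.exp (-t)‖ < 1 := by
        rw [norm_mul, hz, one_mul, norm_real, Real.norm_of_nonneg (Real.exp_pos _).le]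
        exact Real.exp_lt_one_iff.2 (by simpa using ht)
      have := (hasSum_geometric_of_norm_lt_one hr).mul_left (z * Real.exp (-t))
      rw [← div_eq_mul_inv] at this
      refine this.congr_fun fun n => ?_
      have : (Real.exp (-(n + 1 : ℝ) * t) : ℂ) = (Real.exp (-t) : ℂ) ^ (n + 1) := by
        rw [← ofReal_pow, ← Real.exp_nat_mul]
        congr 2
        push_cast; ring
      rw [this]
      ring
    · simp only [norm_pow, hz, one_pow]
      have := (summable_nat_add_iff 1).2 (Real.summable_one_div_nat_rpow.2 hs)
      simpa using this
  have hmd : DifferentiableAt ℂ (mellin F) 1 := by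
    refine mellin_differentiableAt_of_isBigO_rpow_exp (a := 1) (b := 0) one_pos ?_ ?_ ?_
      (by simp)
    · exact (hcont.mono Ioi_subset_Ici_self).locallyIntegrableOn measurableSet_Ioi
    · refine IsBigO.of_bound C ?_
      filter_upwards [eventually_ge_atTop 0] with t ht
      rw [Real.norm_of_nonneg (Real.exp_pos _).le]
      exact (hC t ht).2
    · refine IsBigO.of_bound |C| ?_
      filter_upwards [self_mem_nhdsWithin] with t ht
      have ht' : 0 ≤ t := le_of_lt ht
      refine (hC t ht').2.trans ?_
      simp only [neg_zero, Real.rpow_zero, norm_one, mul_one]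
      have : Real.exp (-1 * t) ≤ 1 := Real.exp_le_one_iff.2 (by linarith)
      calc C * Real.exp (-1 * t) ≤ |C| * Real.exp (-1 * t) := by
            gcongr; exact le_abs_self C
        _ ≤ |C| := mul_le_of_le_one_right (abs_nonneg C) this
  have hval : expZeta x 1 = mellin F 1 := by
    have hpath : Tendsto (fun n : ℝ => (n : ℂ)) (𝓝[>] 1) (𝓝 1) :=
      (Complex.continuous_ofReal.tendsto' 1 1 (by simp)).mono_left nhdsWithin_le_nhds
    have hE : ContinuousAt (fun s => Complex.Gamma s * expZeta x s) 1 := by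
      refine ContinuousAt.mul ?_ (differentiable_expZeta_of_ne_zero hx0).continuous.continuousAt
      refine (differentiableAt_Gamma 1 fun m h => ?_).continuousAt
      have := congrArg re h
      simp at this
      have h2 : (0 : ℝ) ≤ m := m.cast_nonneg
      linarith
    have h1 := hmd.continuousAt.tendsto.comp hpath
    have h2 := hE.tendsto.comp hpath
    have h3 : (mellin F ∘ fun n : ℝ => (n : ℂ)) =ᶠ[𝓝[>] 1]
        ((fun s => Complex.Gamma s * expZeta x s) ∘ fun n : ℝ => (n : ℂ)) := by
      filter_upwards [self_mem_nhdsWithin] with r hr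
      exact hmel _ (by simpa using hr)
    have h4 := tendsto_nhds_unique (h1.congr' h3) h2
    simpa using h4.symm
  rw [hval]
  have hint : IntegrableOn F (Ioi 0) := by
    have := (exp_neg_integrableOn_Ioi 0 one_pos).const_mul C
    refine Integrable.mono' this
      ((hcont.mono Ioi_subset_Ici_self).aestronglyMeasurable measurableSet_Ioi) ?_
    refine (ae_restrict_iff' measurableSet_Ioi).2 (ae_of_all _ fun t ht => ?_)
    exact (hC t (le_of_lt ht)).2
  have hexp : ∀ t : ℝ, HasDerivAt (fun t : ℝ => 1 - z * (Real.exp (-t) : ℂ))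
      (z * Real.exp (-t)) t := by
    intro t
    have := (((hasDerivAt_neg t).exp).ofReal_comp.const_mul z).const_sub 1
    refine this.congr_deriv ?_
    push_cast
    ring
  have hI := integral_Ioi_of_hasDerivAt_of_tendsto (a := 0)
    (f := fun t : ℝ => log (1 - z * Real.exp (-t))) (f' := F) (m := 0) ?_ ?_ hint ?_
  · rw [mellin]
    simpa using hI
  · exact ((hexp 0).clog_real (hC 0 le_rfl).1).continuousAt.continuousWithinAt
  · exact fun t ht => (hexp t).clog_real (hC t (le_of_lt ht)).1
  · have h0 : Tendsto (fun t : ℝ => 1 - z * (Real.exp (-t) : ℂ)) atTop (𝓝 (1 - z * (0 : ℝ))) :=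
      ((Complex.continuous_ofReal.tendsto 0).comp
        (Real.tendsto_exp_neg_atTop_nhds_zero)).const_mul z |>.const_sub 1
    have h1 : (1 - z * ((0 : ℝ) : ℂ)) = 1 := by simp
    rw [h1] at h0
    simpa using h0.clog (Or.inl (by simp))

theorem sinZeta_one {x : ℝ} (hx : x ∈ Ioo (0 : ℝ) 1) :
    sinZeta x 1 = Real.pi / 2 - Real.pi * x := by
  have key : ∀ {y : ℝ}, y ∈ Ioo (0 : ℝ) 1 → log (1 - cexp (2 * Real.pi * I * y)) =
      Real.log (2 * Real.sin (Real.pi * y)) + ((Real.pi * y - Real.pi / 2 : ℝ) : ℂ) * I := by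
    intro y hy
    have hpos : 0 < 2 * Real.sin (Real.pi * y) := by
      refine mul_pos two_pos (Real.sin_pos_of_pos_of_lt_pi (mul_pos Real.pi_pos hy.1) ?_)
      exact mul_lt_of_lt_one_right Real.pi_pos hy.2
    have h1 : 1 - cexp (2 * Real.pi * I * y) = ((2 * Real.sin (Real.pi * y) : ℝ) : ℂ) *
        cexp (((Real.pi * y - Real.pi / 2 : ℝ) : ℂ) * I) := by
      have e1 : cexp (2 * Real.pi * I * y) = cexp (Real.pi * y * I) * cexp (Real.pi * y * I) := by
        rw [← Complex.exp_add]; ring_nf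
      have e2 : cexp (((Real.pi * y - Real.pi / 2 : ℝ) : ℂ) * I) = cexp (Real.pi * y * I) * -I := by
        rw [← Complex.exp_neg_pi_div_two_mul_I, ← Complex.exp_add]
        push_cast; ring_nf
      have e3 : cexp (-(Real.pi * y) * I) * cexp (Real.pi * y * I) = 1 := by
        rw [← Complex.exp_add]; simp
      rw [e1, e2]
      push_cast
      rw [Complex.sin]
      linear_combination (-1 : ℂ) * e3 + (cexp (-(Real.pi * y) * I) * cexp (Real.pi * y * I) -
        cexp (Real.pi * y * I) * cexp (Real.pi * y * I)) * I_sq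
    rw [h1, log_ofReal_mul hpos (Complex.exp_ne_zero _), Complex.log_exp]
    · have := mul_pos Real.pi_pos hy.1
      have := Real.pi_pos
      simp only [mul_im, ofReal_re, I_im, mul_one, ofReal_im, I_re, mul_zero, add_zero]
      linarith
    · have := mul_lt_of_lt_one_right Real.pi_pos hy.2
      have := Real.pi_pos
      simp only [mul_im, ofReal_re, I_im, mul_one, ofReal_im, I_re, mul_zero, add_zero]
      linarith
  have hx' : 1 - x ∈ Ioo (0 : ℝ) 1 := ⟨by linarith [hx.2], by linarith [hx.1]⟩
  have hneg : (-(x : UnitAddCircle)) = ((1 - x : ℝ) : UnitAddCircle) := by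
    rw [AddCircle.coe_sub, AddCircle.coe_period, zero_sub]
  rw [sinZeta_eq, hneg, expZeta_one hx, expZeta_one hx', key hx, key hx',
    show Real.pi * (1 - x) = Real.pi - Real.pi * x by ring, Real.sin_pi_sub]
  have : (2 * I) ≠ 0 := by simp
  field_simp
  push_cast
  ring

end SinZeta

section Helpers

open Complex HurwitzZeta Filter Topology Set ZMod

theorem sinZeta_zero_left (s : ℂ) : sinZeta 0 s = 0 := by
  have h := sinZeta_neg 0 s
  rwa [neg_zero, self_eq_neg] at h

theorem periodicBernoulli_eq_sinZeta {k : ℕ} (hko : Odd k) (x : ℝ) :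
    (periodicBernoulli k x : ℂ) =
      2 * ((-1 : ℂ) ^ ((k + 1) / 2) * (Nat.factorial k) / (2 * Real.pi) ^ k) * sinZeta x k := by
  have hcoe : (x : UnitAddCircle) = (Int.fract x : ℝ) := by
    conv_lhs => rw [← Int.fract_add_floor x]
    rw [AddCircle.coe_add, add_eq_left, AddCircle.coe_eq_zero_iff]
    exact ⟨⌊x⌋, by simp⟩
  have hpi : (Real.pi : ℂ) ≠ 0 := by exact_mod_cast Real.pi_ne_zero
  have h0 := Int.fract_nonneg x
  have h1 := Int.fract_lt_one x
  rw [hcoe]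
  unfold periodicBernoulli
  generalize Int.fract x = y at h0 h1
  obtain ⟨m, rfl⟩ := hko
  have hm2 : (2 * m + 1 + 1) / 2 = m + 1 := by omega
  rw [hm2]
  rcases Nat.eq_zero_or_pos m with rfl | hm
  · rcases h0.eq_or_lt with rfl | hy
    · simp [sinZeta_zero_left]
    · have := sinZeta_one ⟨hy, h1⟩
      simp only [mul_zero, zero_add, hy.ne', and_false, if_false, Polynomial.bernoulli_one,
        Nat.cast_one, this]
      simp
      field_simp
      ring
  · have hm0 : m ≠ 0 := hm.ne'
    have := sinZeta_two_mul_nat_add_one hm0 (x := y) ⟨h0, h1.le⟩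
    push_cast
    have hB : ((Polynomial.aeval y (Polynomial.bernoulli (2 * m + 1)) : ℝ) : ℂ) =
        ((Polynomial.bernoulli (2 * m + 1)).map (algebraMap ℚ ℂ)).eval (y : ℂ) := by
      rw [Polynomial.eval_map_algebraMap]
      exact (Polynomial.aeval_algebraMap_apply ℂ y _).symm
    rw [if_neg (by omega), this, hB]
    have hf : (((2 * m + 1).factorial : ℕ) : ℂ) ≠ 0 := by
      exact_mod_cast Nat.factorial_ne_zero _
    have hs : ((-1 : ℂ) ^ (m + 1)) * (-1) ^ (m + 1) = 1 := by
      rw [← mul_pow]; simp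
    field_simp
    linear_combination
      (-(Polynomial.eval (y : ℂ) ((Polynomial.bernoulli (2 * m + 1)).map (algebraMap ℚ ℂ)))) * hs

/-- The function `sin (2π x / N)` on `ZMod N`. -/
noncomputable def zmodSin (N : ℕ) [NeZero N] (x : ZMod N) : ℂ :=
  (stdAddChar x - stdAddChar (-x)) / (2 * I)

theorem zmodSin_neg {N : ℕ} [NeZero N] (x : ZMod N) : zmodSin N (-x) = -zmodSin N x := by
  simp only [zmodSin, neg_neg]
  ring

theorem zmodSin_natCast {N : ℕ} [NeZero N] (m : ℕ) :
    zmodSin N (m : ZMod N) = Real.sin (2 * Real.pi * m / N) := by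
  have h1 : ((m : ℕ) : ZMod N) = ((m : ℤ) : ZMod N) := by simp
  have h2 : -((m : ℕ) : ZMod N) = ((-m : ℤ) : ZMod N) := by simp
  rw [zmodSin, h2, h1, stdAddChar_coe, stdAddChar_coe, ofReal_sin, Complex.sin]
  have : (2 * I) ≠ 0 := by simp
  push_cast
  rw [show -(2 * Real.pi * m / N : ℂ) * I = 2 * Real.pi * I * -m / N by ring,
    show (2 * Real.pi * m / N : ℂ) * I = 2 * Real.pi * I * m / N by ring]
  have h3 (u v : ℂ) : (u - v) / (2 * I) = (v - u) * I / 2 := by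
    field_simp
    linear_combination (u - v) * I_sq
  exact h3 _ _

theorem LFunction_zmodSin {N : ℕ} [NeZero N] (x : ZMod N) (s : ℂ) :
    LFunction (fun n => zmodSin N (x * n)) s = sinZeta (toAddCircle x) s := by
  rcases eq_or_ne x 0 with rfl | hx
  · simp [LFunction, zmodSin, sinZeta_zero_left]
  · rw [sinZeta_eq, ← map_neg, ← LFunction_stdAddChar_eq_expZeta x s (.inl hx),
      ← LFunction_stdAddChar_eq_expZeta (-x) s (.inl (neg_ne_zero.2 hx))]
    simp only [LFunction, zmodSin, ← mul_sub, ← Finset.sum_sub_distrib, ← sub_mul, neg_mul]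
    rw [mul_div_assoc, Finset.sum_div]
    congr 1
    refine Finset.sum_congr rfl fun n _ => ?_
    ring

theorem LFunction_comp_castHom {d N : ℕ} [NeZero d] [NeZero N] (h : d ∣ N) {Φ : ZMod d → ℂ}
    (hΦ : Φ.Odd) (s : ℂ) :
    LFunction (fun n : ZMod N => Φ (ZMod.castHom h (ZMod d) n)) s = LFunction Φ s := by
  have hΨ : (fun n : ZMod N => Φ (ZMod.castHom h (ZMod d) n)).Odd := fun n => by
    simp only [map_neg, hΦ _]
  have h1 := (differentiable_LFunction_of_sum_zero hΦ.sum_eq_zero).differentiableOn.analyticOnNhd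
    isOpen_univ
  have h2 := (differentiable_LFunction_of_sum_zero hΨ.sum_eq_zero).differentiableOn.analyticOnNhd
    isOpen_univ
  refine congrFun (AnalyticOnNhd.eq_of_eventuallyEq h2 h1 (z₀ := 2) ?_) s
  filter_upwards [(continuous_re.isOpen_preimage _ isOpen_Ioi).mem_nhds
    (show (2 : ℂ) ∈ re ⁻¹' Ioi 1 by simp)] with z hz
  rw [LFunction_eq_LSeries _ hz, LFunction_eq_LSeries _ hz]
  simp

/-- The representative `i + 1` in `ZMod N` of a pair `{a, -a}` with `a ≠ -a`. -/
def posRep (N : ℕ) (i : Fin ((N - 1) / 2)) : ZMod N := ((i + 1 : ℕ) : ZMod N)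

theorem posRep_injective (N : ℕ) : Function.Injective (posRep N) := by
  intro i j h
  have hi := i.isLt
  have hj := j.isLt
  have := (ZMod.natCast_eq_natCast_iff' _ _ _).1 h
  rw [Nat.mod_eq_of_lt (by omega), Nat.mod_eq_of_lt (by omega)] at this
  exact Fin.ext (by omega)

theorem posRep_ne_neg (N : ℕ) (i j : Fin ((N - 1) / 2)) : posRep N i ≠ -posRep N j := by
  intro h
  have hi := i.isLt
  have hj := j.isLt
  rw [eq_neg_iff_add_eq_zero, posRep, posRep, ← Nat.cast_add, ZMod.natCast_eq_zero_iff] at h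
  have := Nat.le_of_dvd (by omega) h
  omega

theorem posRep_cases {N : ℕ} [NeZero N] (a : ZMod N) :
    (∃ i, a = posRep N i) ∨ (∃ i, a = -posRep N i) ∨ a = -a := by
  have ha := a.val_lt
  by_cases h0 : a.val = 0
  · right; right
    rw [(ZMod.val_eq_zero a).1 h0, neg_zero]
  by_cases h1 : 2 * a.val < N
  · refine Or.inl ⟨⟨a.val - 1, by omega⟩, ?_⟩
    rw [posRep, Nat.sub_add_cancel (by omega), ZMod.natCast_zmod_val]
  by_cases h2 : N < 2 * a.val
  · refine Or.inr (Or.inl ⟨⟨N - a.val - 1, by omega⟩, ?_⟩)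
    rw [posRep, Nat.sub_add_cancel (by omega), Nat.cast_sub ha.le, ZMod.natCast_zmod_val]
    simp
  · right; right
    rw [eq_neg_iff_add_eq_zero, ← ZMod.natCast_zmod_val a, ← Nat.cast_add,
      ZMod.natCast_eq_zero_iff]
    exact ⟨1, by omega⟩

/-- Twice the projection of functions on `ZMod N` to odd functions, in the coordinates given by
`posRep`. -/
def oddProj (N : ℕ) : Matrix (Fin ((N - 1) / 2)) (ZMod N) ℂ :=
  Matrix.of fun i a => (if a = posRep N i then 1 else 0) - if a = -posRep N i then 1 else 0

theorem sum_oddProj_mul {N : ℕ} [NeZero N] {f : ZMod N → ℂ} (hf : f.Odd) (a : ZMod N) :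
    ∑ i, oddProj N i a * f (posRep N i) = f a := by
  have hinj := posRep_injective N
  rcases posRep_cases a with ⟨i, rfl⟩ | ⟨i, rfl⟩ | h
  · simp [oddProj, posRep_ne_neg, hinj.eq_iff]
  · have h1 (j) : -posRep N i ≠ posRep N j := (posRep_ne_neg N j i).symm
    simp [oddProj, h1, hinj.eq_iff, hf _]
  · have h1 (j) : a ≠ posRep N j := fun h2 => posRep_ne_neg N j j (by rw [← h2]; exact h)
    have h2 (j) : a ≠ -posRep N j := fun h2 => by
      rw [h, neg_inj] at h2; exact h1 j h2
    have h3 : f a = 0 := by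
      have := hf a
      rw [← h] at this
      exact self_eq_neg.1 this
    simp [oddProj, h1, h2, h3]

theorem oddProj_mul_apply {N : ℕ} [NeZero N] {m : Type*} (X : Matrix (ZMod N) m ℂ) (i) (b : m) :
    (oddProj N * X) i b = X (posRep N i) b - X (-posRep N i) b := by
  simp [Matrix.mul_apply, oddProj, sub_mul, Finset.sum_sub_distrib]

theorem oddProj_mul_transpose (N : ℕ) [NeZero N] :
    oddProj N * (oddProj N).transpose = (2 : ℂ) • 1 := by
  ext i j
  rw [oddProj_mul_apply]
  have h1 (i j) : -posRep N i ≠ posRep N j := (posRep_ne_neg N j i).symm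
  simp only [Matrix.transpose_apply, oddProj, Matrix.of_apply, posRep_ne_neg, h1, if_false,
    (posRep_injective N).eq_iff, neg_inj, Matrix.smul_apply, Matrix.one_apply, smul_eq_mul]
  split_ifs <;> norm_num

theorem transpose_oddProj_mul_oddProj_apply {N : ℕ} [NeZero N] (a b : ZMod N) :
    ((oddProj N).transpose * oddProj N) a b =
      (if a = b then 1 else 0) - if a = -b then 1 else 0 := by
  have hodd : (fun c : ZMod N => ((if c = b then 1 else 0) - if c = -b then 1 else 0 : ℂ)).Odd := by
    intro c
    simp only [neg_eq_iff_eq_neg, neg_neg]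
    ring
  have := sum_oddProj_mul hodd a
  rw [Matrix.mul_apply, ← this]
  refine Finset.sum_congr rfl fun i _ => ?_
  simp only [Matrix.transpose_apply, oddProj, Matrix.of_apply, eq_comm (a := b),
    neg_eq_iff_eq_neg]

theorem transpose_oddProj_mul_oddProj_mul {N : ℕ} [NeZero N] {m : Type*}
    {X : Matrix (ZMod N) m ℂ} (hX : ∀ a b, X (-a) b = -X a b) :
    (oddProj N).transpose * oddProj N * X = (2 : ℂ) • X := by
  ext a b
  rw [Matrix.mul_apply]
  simp only [transpose_oddProj_mul_oddProj_apply, sub_mul, ite_mul, one_mul, zero_mul,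
    Finset.sum_sub_distrib, ← neg_eq_iff_eq_neg, Finset.sum_ite_eq, Finset.mem_univ, if_true, hX,
    Matrix.smul_apply, smul_eq_mul]
  ring

theorem mul_transpose_oddProj_mul_oddProj {N : ℕ} [NeZero N] {m : Type*}
    {X : Matrix m (ZMod N) ℂ} (hX : ∀ a b, X a (-b) = -X a b) :
    X * ((oddProj N).transpose * oddProj N) = (2 : ℂ) • X := by
  have := transpose_oddProj_mul_oddProj_mul (X := X.transpose) (fun a b => hX b a)
  have h2 := congrArg Matrix.transpose this
  simpa [Matrix.transpose_mul] using h2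

/-- The restriction of a matrix indexed by `ZMod N` to the indices `1, …, ⌊(N - 1) / 2⌋`. -/
def posMinor {N : ℕ} (X : Matrix (ZMod N) (ZMod N) ℂ) :
    Matrix (Fin ((N - 1) / 2)) (Fin ((N - 1) / 2)) ℂ :=
  X.submatrix (posRep N) (posRep N)

theorem oddProj_mul_mul_transpose {N : ℕ} [NeZero N] {X : Matrix (ZMod N) (ZMod N) ℂ}
    (hl : ∀ a b, X (-a) b = -X a b) (hr : ∀ a b, X a (-b) = -X a b) :
    oddProj N * X * (oddProj N).transpose = (4 : ℂ) • posMinor X := by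
  ext i j
  have h1 : oddProj N * X * (oddProj N).transpose =
      (oddProj N * (oddProj N * X).transpose).transpose := by
    simp [Matrix.transpose_mul, Matrix.mul_assoc]
  rw [h1, Matrix.transpose_apply, oddProj_mul_apply, Matrix.transpose_apply,
    Matrix.transpose_apply, oddProj_mul_apply, oddProj_mul_apply, Matrix.smul_apply, posMinor,
    Matrix.submatrix_apply, hl, hr, hl, hr]
  simp only [smul_eq_mul]
  ring

theorem posMinor_mul {N : ℕ} [NeZero N] {X Y : Matrix (ZMod N) (ZMod N) ℂ}
    (hXl : ∀ a b, X (-a) b = -X a b) (hXr : ∀ a b, X a (-b) = -X a b)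
    (hYl : ∀ a b, Y (-a) b = -Y a b) (hYr : ∀ a b, Y a (-b) = -Y a b) :
    posMinor (X * Y) = (2 : ℂ) • (posMinor X * posMinor Y) := by
  have h1 : oddProj N * (X * Y) * (oddProj N).transpose = (4 : ℂ) • posMinor (X * Y) := by
    refine oddProj_mul_mul_transpose (fun a b => ?_) fun a b => ?_
    · simp [Matrix.mul_apply, hXl]
    · simp [Matrix.mul_apply, hYr]
  have h2 : (oddProj N * X * (oddProj N).transpose) * (oddProj N * Y * (oddProj N).transpose) =
      (2 : ℂ) • (oddProj N * (X * Y) * (oddProj N).transpose) := by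
    calc _ = oddProj N * X * ((oddProj N).transpose * oddProj N * Y) * (oddProj N).transpose := by
          simp only [Matrix.mul_assoc]
      _ = _ := by
          rw [transpose_oddProj_mul_oddProj_mul hYl]
          simp [Matrix.mul_assoc]
  rw [oddProj_mul_mul_transpose hXl hXr, oddProj_mul_mul_transpose hYl hYr, h1] at h2
  simp only [Matrix.smul_mul, Matrix.mul_smul, smul_smul] at h2
  have h3 := congrArg (fun Z => (1 / 8 : ℂ) • Z) h2
  simp only [smul_smul] at h3
  norm_num at h3
  rw [← h3]

/-- The determinant of the odd part of `X` is that of `X` extended by the identity on even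
functions. -/
theorem det_posMinor {N : ℕ} [NeZero N] {X : Matrix (ZMod N) (ZMod N) ℂ}
    (hl : ∀ a b, X (-a) b = -X a b) (hr : ∀ a b, X a (-b) = -X a b) :
    ((2 : ℂ) • posMinor X).det =
      (1 - (1 / 2 : ℂ) • ((oddProj N).transpose * oddProj N) + X).det := by
  set P := oddProj N
  have hX : (1 / 4 : ℂ) • (P.transpose * (P * X * P.transpose) * P) = X := by
    calc _ = (1 / 4 : ℂ) • ((P.transpose * P * X) * (P.transpose * P)) := by
          simp only [Matrix.mul_assoc]
      _ = _ := by
          rw [transpose_oddProj_mul_oddProj_mul hl, Matrix.smul_mul,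
            mul_transpose_oddProj_mul_oddProj hr, smul_smul, smul_smul]
          norm_num
  have h := Matrix.det_one_add_mul_comm P.transpose
    ((1 / 4 : ℂ) • (P * X * P.transpose * P) - (1 / 2 : ℂ) • P)
  have e1 : 1 + P.transpose * ((1 / 4 : ℂ) • (P * X * P.transpose * P) - (1 / 2 : ℂ) • P) =
      1 - (1 / 2 : ℂ) • (P.transpose * P) + X := by
    conv_rhs => rw [← hX]
    simp only [Matrix.mul_sub, Matrix.mul_smul, Matrix.mul_assoc]
    abel
  have e2 : 1 + ((1 / 4 : ℂ) • (P * X * P.transpose * P) - (1 / 2 : ℂ) • P) * P.transpose =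
      (2 : ℂ) • posMinor X := by
    rw [Matrix.sub_mul, Matrix.smul_mul, Matrix.smul_mul, Matrix.mul_assoc _ P,
      oddProj_mul_transpose, oddProj_mul_mul_transpose hl hr, Matrix.mul_smul, Matrix.mul_one]
    simp only [smul_smul]
    norm_num
  rw [← e1, h, e2]

/-- The matrix `sin (2π i j / N)`, for `1 ≤ i, j ≤ ⌊(N - 1) / 2⌋`. -/
noncomputable def sinMatrix (N : ℕ) : Matrix (Fin ((N - 1) / 2)) (Fin ((N - 1) / 2)) ℝ :=
  Matrix.of fun i j => Real.sin (2 * Real.pi * ((i + 1) * (j + 1) : ℕ) / N)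

theorem posMinor_zmodSin (N : ℕ) [NeZero N] :
    posMinor (Matrix.of fun a b : ZMod N => zmodSin N (a * b)) = (sinMatrix N).map (↑) := by
  ext i j
  simp only [posMinor, Matrix.submatrix_apply, Matrix.of_apply, posRep, ← Nat.cast_mul,
    zmodSin_natCast, sinMatrix, Matrix.map_apply]

theorem sum_zmodSin_mul_zmodSin {N : ℕ} [NeZero N] (a b : ZMod N) :
    ∑ c, zmodSin N (a * c) * zmodSin N (c * b) =
      N / 2 * ((if a = b then 1 else 0) - if a = -b then 1 else 0) := by
  have key (x : ZMod N) : ∑ c : ZMod N, (stdAddChar (c * x) : ℂ) =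
      if x = 0 then (N : ℂ) else 0 := by
    have := AddChar.sum_mulShift x (isPrimitive_stdAddChar N)
    simpa [ZMod.card] using this
  have h (c : ZMod N) : zmodSin N (a * c) * zmodSin N (c * b) =
      (stdAddChar (c * (a - b)) + stdAddChar (c * (b - a)) - stdAddChar (c * (a + b)) -
        stdAddChar (c * (-(a + b)))) / 4 := by
    rw [zmodSin, zmodSin, show c * (a - b) = a * c + -(c * b) by ring,
      show c * (b - a) = -(a * c) + c * b by ring, show c * (a + b) = a * c + c * b by ring,
      show c * (-(a + b)) = -(a * c) + -(c * b) by ring]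
    simp only [AddChar.map_add_eq_mul]
    have : (2 * I) ≠ 0 := by simp
    field_simp
    rw [I_sq]
    ring
  simp only [h, ← Finset.sum_div, Finset.sum_sub_distrib, Finset.sum_add_distrib, key,
    sub_eq_zero, neg_eq_zero, eq_comm (a := b), add_eq_zero_iff_eq_neg]
  split_ifs <;> ring

theorem det_sinMatrix_sq (N : ℕ) [NeZero N] :
    (sinMatrix N).det ^ 2 = ((N : ℝ) / 4) ^ ((N - 1) / 2) := by
  set S := Matrix.of fun a b : ZMod N => zmodSin N (a * b) with hS
  have hl : ∀ a b, S (-a) b = -S a b := fun a b => by simp [hS, zmodSin_neg]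
  have hr : ∀ a b, S a (-b) = -S a b := fun a b => by simp [hS, zmodSin_neg]
  have h1 := posMinor_mul hl hr hl hr
  have h2 : posMinor (S * S) = (N / 2 : ℂ) • 1 := by
    ext i j
    rw [posMinor, Matrix.submatrix_apply, Matrix.mul_apply]
    simp only [hS, Matrix.of_apply, sum_zmodSin_mul_zmodSin, posRep_ne_neg, if_false,
      (posRep_injective N).eq_iff, Matrix.smul_apply, Matrix.one_apply, smul_eq_mul, sub_zero]
  rw [h2, posMinor_zmodSin] at h1
  have h3 := congrArg Matrix.det h1
  rw [Matrix.det_smul, Matrix.det_smul, Matrix.det_mul, Matrix.det_one, Fintype.card_fin,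
    mul_one] at h3
  have h4 : ((sinMatrix N).map ((↑) : ℝ → ℂ)).det = ((sinMatrix N).det : ℂ) :=
    (RingHom.map_det Complex.ofRealHom (sinMatrix N)).symm
  rw [h4] at h3
  have h5 : ((N : ℝ) / 2) ^ ((N - 1) / 2) =
      2 ^ ((N - 1) / 2) * ((sinMatrix N).det * (sinMatrix N).det) := by
    apply Complex.ofReal_injective
    push_cast
    exact h3
  have h6 : ((N : ℝ) / 2) ^ ((N - 1) / 2) = 2 ^ ((N - 1) / 2) * ((N : ℝ) / 4) ^ ((N - 1) / 2) := by
    rw [← mul_pow]; congr 1; ring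
  rw [h6] at h5
  rw [sq]
  exact (mul_left_cancel₀ (by positivity) h5).symm

theorem exists_det_sinMatrix_eq (N : ℕ) :
    ∃ r : ℝ, 0 < r ∧
      (sinMatrix N).det = (-1) ^ ((N - 1) / 2 * ((N - 1) / 2 - 1) / 2) * r := by
  set m := (N - 1) / 2 with hm
  set θ : Fin m → ℝ := fun i => 2 * Real.pi * (i + 1) / N with hθ
  have hpos : ∀ i, 0 < θ i := fun i => by
    have := i.isLt
    have : (0 : ℝ) < N := by exact_mod_cast (by omega : 0 < N)
    have := Real.pi_pos
    positivity
  have hlt : ∀ i, θ i < Real.pi := fun i => by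
    have hi := i.isLt
    have : (0 : ℝ) < N := by exact_mod_cast (by omega : 0 < N)
    have h2 : (2 * (i + 1) : ℝ) < N := by exact_mod_cast (by omega : 2 * ((i : ℕ) + 1) < N)
    rw [hθ]
    simp only
    rw [div_lt_iff₀ this]
    nlinarith [Real.pi_pos]
  have hmono : ∀ i j, i < j → Real.cos (θ j) < Real.cos (θ i) := fun i j hij => by
    refine Real.cos_lt_cos_of_nonneg_of_le_pi (hpos i).le (hlt j).le ?_
    have hi := i.isLt
    have : (0 : ℝ) < N := by exact_mod_cast (by omega : 0 < N)
    have : (i : ℝ) < j := by exact_mod_cast hij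
    have := Real.pi_pos
    simp only [hθ]
    gcongr
  have hS : sinMatrix N = Matrix.of fun i j : Fin m => Real.sin (θ i) *
      (Matrix.of fun i j : Fin m =>
        (Polynomial.Chebyshev.U ℝ (j : ℕ)).eval (Real.cos (θ i))) i j := by
    ext i j
    simp only [sinMatrix, Matrix.of_apply]
    rw [mul_comm (Real.sin _), Polynomial.Chebyshev.U_real_cos]
    congr 1
    simp only [hθ]
    push_cast
    ring
  have hdeg (j : Fin m) : (Polynomial.Chebyshev.U ℝ (j : ℕ)).natDegree = j :=
    Polynomial.Chebyshev.natDegree_U_natCast ℝ j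
  have hU : (Matrix.of fun i j : Fin m => (Polynomial.Chebyshev.U ℝ (j : ℕ)).coeff i).det =
      ∏ j : Fin m, (2 : ℝ) ^ (j : ℕ) := by
    rw [Matrix.det_of_isUpperTriangular
      (Matrix.matrixOfPolynomials_blockTriangular _ fun i => (hdeg i).le)]
    refine Finset.prod_congr rfl fun j _ => ?_
    rw [Matrix.of_apply, ← Polynomial.Chebyshev.leadingCoeff_U_natCast ℝ j,
      Polynomial.leadingCoeff, hdeg]
  have hcount : ∑ i : Fin m, (Finset.Ioi i).card = m * (m - 1) / 2 := by
    simp only [Fin.card_Ioi]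
    rw [Fin.sum_univ_eq_sum_range (fun i => m - 1 - i) m, Finset.sum_range_reflect (fun i => i) m,
      Finset.sum_range_id]
  have hV : (Matrix.vandermonde fun i => Real.cos (θ i)).det =
      (-1) ^ (m * (m - 1) / 2) *
        ∏ i : Fin m, ∏ j ∈ Finset.Ioi i, (Real.cos (θ i) - Real.cos (θ j)) := by
    rw [Matrix.det_vandermonde, ← hcount, ← Finset.prod_pow_eq_pow_sum, ← Finset.prod_mul_distrib]
    refine Finset.prod_congr rfl fun i _ => ?_
    rw [← Finset.prod_const, ← Finset.prod_mul_distrib]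
    refine Finset.prod_congr rfl fun j _ => ?_
    ring
  refine ⟨(∏ i, Real.sin (θ i)) * (∏ i : Fin m, ∏ j ∈ Finset.Ioi i,
    (Real.cos (θ i) - Real.cos (θ j))) * ∏ j : Fin m, (2 : ℝ) ^ (j : ℕ), ?_, ?_⟩
  · refine mul_pos (mul_pos ?_ ?_) ?_
    · exact Finset.prod_pos fun i _ => Real.sin_pos_of_pos_of_lt_pi (hpos i) (hlt i)
    · refine Finset.prod_pos fun i _ => Finset.prod_pos fun j hj => ?_
      exact sub_pos.2 (hmono i j (Finset.mem_Ioi.1 hj))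
    · exact Finset.prod_pos fun i _ => by positivity
  · rw [hS, Matrix.det_mul_column,
      Matrix.eval_matrixOfPolynomials_eq_vandermonde_mul_matrixOfPolynomials
      _ _ fun i => (hdeg i).le, Matrix.det_mul, hU, hV]
    ring

theorem det_sinMatrix (N : ℕ) [NeZero N] :
    (sinMatrix N).det = (-1) ^ ((N - 1) / 2 * ((N - 1) / 2 - 1) / 2) *
      (Real.sqrt N / 2) ^ ((N - 1) / 2) := by
  obtain ⟨r, hr, h⟩ := exists_det_sinMatrix_eq N
  have h2 := det_sinMatrix_sq N
  rw [h, mul_pow, ← pow_mul, mul_comm _ 2, pow_mul, neg_one_sq, one_pow, one_mul] at h2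
  have h3 : r = (Real.sqrt N / 2) ^ ((N - 1) / 2) := by
    refine (pow_left_inj₀ hr.le (by positivity) two_ne_zero).1 ?_
    rw [h2, ← pow_mul, mul_comm _ 2, pow_mul, div_pow (Real.sqrt N),
      Real.sq_sqrt (Nat.cast_nonneg N)]
    norm_num
  rw [h, h3]

/-- Factorisation of the group determinant of `(ZMod d)ˣ`. -/
theorem det_unitsMatrix {d : ℕ} [NeZero d] {ι : Type*} [Fintype ι] (w : ι → ℂ) (p : ι → ZMod d) :
    (Matrix.of fun u v : (ZMod d)ˣ => ∑ n, if p n * u = v then w n else 0).det =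
      ∏ χ : DirichletCharacter ℂ d, ∑ n, w n * χ (p n) := by
  classical
  set M := Matrix.of fun u v : (ZMod d)ˣ => ∑ n, if p n * u = v then w n else 0 with hM
  set X : Matrix (ZMod d)ˣ (DirichletCharacter ℂ d) ℂ := Matrix.of fun u χ => χ u with hX
  set Y : Matrix (DirichletCharacter ℂ d) (ZMod d)ˣ ℂ :=
    Matrix.of fun χ u => (d.totient : ℂ)⁻¹ * χ (u : ZMod d)⁻¹ with hY
  have hφ : (d.totient : ℂ) ≠ 0 := by
    exact_mod_cast (Nat.totient_pos.2 (NeZero.pos d)).ne'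
  have hXY : X * Y = 1 := by
    ext u v
    have h := DirichletCharacter.sum_char_inv_mul_char_eq ℂ v.isUnit (u : ZMod d)
    have h2 : (X * Y) u v = (d.totient : ℂ)⁻¹ *
        ∑ χ : DirichletCharacter ℂ d, χ (v : ZMod d)⁻¹ * χ u := by
      rw [Matrix.mul_apply, Finset.mul_sum]
      refine Finset.sum_congr rfl fun χ _ => ?_
      simp only [hX, hY, Matrix.of_apply]
      ring
    rw [h2, h, Matrix.one_apply]
    simp only [Units.val_inj, eq_comm (a := v)]
    split_ifs
    · exact inv_mul_cancel₀ hφ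
    · simp
  have hcard : Fintype.card (ZMod d)ˣ = Fintype.card (DirichletCharacter ℂ d) := by
    rw [ZMod.card_units_eq_totient, ← DirichletCharacter.card_eq_totient_of_hasEnoughRootsOfUnity ℂ,
      Nat.card_eq_fintype_card]
  have hYX : Y * X = 1 := (Matrix.mul_eq_one_comm_of_card_eq _ _ _ hcard).1 hXY
  set D : Matrix (DirichletCharacter ℂ d) (DirichletCharacter ℂ d) ℂ :=
    Matrix.diagonal fun χ => ∑ n, w n * χ (p n) with hD
  have hMX : M * X = X * D := by
    ext u χ
    rw [hD, Matrix.mul_diagonal, Matrix.mul_apply]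
    simp only [hM, hX, Matrix.of_apply, Finset.sum_mul, Finset.mul_sum]
    rw [Finset.sum_comm]
    refine Finset.sum_congr rfl fun n _ => ?_
    have : χ u * (w n * χ (p n)) = w n * χ (p n * u) := by rw [map_mul]; ring
    rw [this]
    by_cases hn : IsUnit (p n)
    · obtain ⟨q, hq⟩ := hn
      rw [← hq, Finset.sum_eq_single (q * u)]
      · simp
      · intro v _ hv
        rw [if_neg, zero_mul]
        rw [← Units.val_mul, Units.val_inj]
        exact hv.symm
      · simp
    · rw [map_mul, MulChar.map_nonunit _ hn, zero_mul, mul_zero]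
      refine Finset.sum_eq_zero fun v _ => ?_
      rw [if_neg, zero_mul]
      intro h
      exact hn (isUnit_of_mul_isUnit_left (h ▸ v.isUnit))
  have hconj : M = X * D * Y := by
    rw [← hMX, Matrix.mul_assoc, hXY, Matrix.mul_one]
  rw [hconj, Matrix.det_conj_of_mul_eq_one hXY hYX, Matrix.det_diagonal]

/-- The matrix by which `∑ n, w n • [n]`, an element of the monoid algebra of `ZMod N`, acts on
`ZMod N`. -/
def monoidMatrix {N : ℕ} [NeZero N] (w : ZMod N → ℂ) : Matrix (ZMod N) (ZMod N) ℂ :=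
  Matrix.of fun a b => ∑ n, if n * a = b then w n else 0

/-- The elements `e * u` of `ZMod (e * d)` with `u` a unit modulo `d` are those with
`gcd (e * u, e * d) = e`. -/
theorem exists_units_equiv_gcd_eq {e d : ℕ} [NeZero e] [NeZero d] :
    ∃ φ : (ZMod d)ˣ ≃ {a : ZMod (e * d) // a.val.gcd (e * d) = e},
      ∀ u, (φ u : ZMod (e * d)) = ((e * (u : ZMod d).val : ℕ) : ZMod (e * d)) := by
  have he : 0 < e := NeZero.pos e
  have hval (u : ZMod d) : ((e * u.val : ℕ) : ZMod (e * d)).val = e * u.val :=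
    ZMod.val_natCast_of_lt ((Nat.mul_lt_mul_left he).2 u.val_lt)
  let f : (ZMod d)ˣ → {a : ZMod (e * d) // a.val.gcd (e * d) = e} := fun u =>
    ⟨((e * (u : ZMod d).val : ℕ) : ZMod (e * d)), by
      rw [hval, Nat.gcd_mul_left, (ZMod.val_coe_unit_coprime u).gcd_eq_one, mul_one]⟩
  refine ⟨Equiv.ofBijective f ⟨fun u v h => ?_, fun ⟨a, ha⟩ => ?_⟩, fun u => rfl⟩
  · have h1 := congrArg ZMod.val (Subtype.ext_iff.1 h)
    simp only [f, hval] at h1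
    exact Units.ext (ZMod.val_injective d (Nat.eq_of_mul_eq_mul_left he h1))
  · have hdvd := Nat.gcd_dvd_left a.val (e * d)
    rw [ha] at hdvd
    obtain ⟨m, hm⟩ := hdvd
    have hlt : m < d := by
      have := a.val_lt
      rw [hm] at this
      exact lt_of_mul_lt_mul_left this he.le
    have hc : m.Coprime d := by
      rw [hm, Nat.gcd_mul_left] at ha
      exact Nat.eq_of_mul_eq_mul_left he (by rw [ha, mul_one])
    refine ⟨ZMod.unitOfCoprime m hc, Subtype.ext ?_⟩
    simp only [f, ZMod.coe_unitOfCoprime]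
    rw [ZMod.val_natCast_of_lt hlt, ← hm, ZMod.natCast_zmod_val]

theorem det_toSquareBlock_monoidMatrix {N e d : ℕ} [NeZero N] [NeZero d] (h : e * d = N)
    (w : ZMod N → ℂ) :
    ((monoidMatrix w).toSquareBlock (fun a => a.val.gcd N) e).det =
      ∏ χ : DirichletCharacter ℂ d, ∑ n, w n * χ ((n.val : ℕ) : ZMod d) := by
  subst h
  have he0 : e ≠ 0 := fun h => NeZero.ne (e * d) (by rw [h, zero_mul])
  have : NeZero e := ⟨he0⟩
  obtain ⟨φ, hφ⟩ := exists_units_equiv_gcd_eq (e := e) (d := d)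
  rw [← det_unitsMatrix, ← Matrix.det_submatrix_equiv_self φ]
  congr 1
  ext u v
  simp only [Matrix.submatrix_apply, Matrix.toSquareBlock_def, Matrix.of_apply, monoidMatrix, hφ]
  refine Finset.sum_congr rfl fun n _ => ?_
  congr 1
  have h1 : n * ((e * (u : ZMod d).val : ℕ) : ZMod (e * d)) =
      ((e * (n.val * (u : ZMod d).val) : ℕ) : ZMod (e * d)) := by
    conv_lhs => rw [← ZMod.natCast_zmod_val n]
    push_cast
    ring
  have h2 : ((n.val : ℕ) : ZMod d) * (u : ZMod d) = ((n.val * (u : ZMod d).val : ℕ) : ZMod d) := by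
    rw [Nat.cast_mul, ZMod.natCast_zmod_val]
  have h3 : (v : ZMod d) = (((v : ZMod d).val : ℕ) : ZMod d) := (ZMod.natCast_zmod_val _).symm
  rw [h1, h2]
  conv_rhs => rw [h3]
  rw [ZMod.natCast_eq_natCast_iff, ZMod.natCast_eq_natCast_iff,
    Nat.ModEq.mul_left_cancel_iff' he0]

theorem det_monoidMatrix {N : ℕ} [NeZero N] (w : ZMod N → ℂ) :
    (monoidMatrix w).det = ∏ d ∈ N.divisors,
      ∏ χ : DirichletCharacter ℂ d, ∑ n, w n * χ ((n.val : ℕ) : ZMod d) := by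
  have htri : (monoidMatrix w).BlockTriangular fun a => a.val.gcd N := by
    intro a b hab
    refine Finset.sum_eq_zero fun n _ => if_neg fun h => ?_
    refine hab.not_ge (Nat.le_of_dvd (Nat.gcd_pos_of_pos_right _ (NeZero.pos N)) ?_)
    refine Nat.dvd_gcd ?_ (Nat.gcd_dvd_right _ _)
    rw [← h, ZMod.val_mul]
    exact (Nat.dvd_mod_iff (Nat.gcd_dvd_right _ _)).2 ((Nat.gcd_dvd_left _ _).mul_left _)
  have himg : Finset.univ.image (fun a : ZMod N => a.val.gcd N) = N.divisors := by
    ext e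
    simp only [Finset.mem_image, Finset.mem_univ, true_and, Nat.mem_divisors]
    constructor
    · rintro ⟨a, rfl⟩
      exact ⟨Nat.gcd_dvd_right _ _, NeZero.ne N⟩
    · rintro ⟨h, -⟩
      refine ⟨(e : ZMod N), ?_⟩
      rw [ZMod.val_natCast, ← Nat.gcd_rec]
      exact Nat.gcd_eq_right h
  rw [htri.det, himg]
  refine Eq.trans ?_ (Nat.prod_div_divisors N fun d => ∏ χ : DirichletCharacter ℂ d,
    ∑ n, w n * χ ((n.val : ℕ) : ZMod d))
  refine Finset.prod_congr rfl fun e he => ?_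
  have hdvd := Nat.dvd_of_mem_divisors he
  have : NeZero (N / e) :=
    ⟨(Nat.div_pos (Nat.le_of_dvd (NeZero.pos N) hdvd) (Nat.pos_of_mem_divisors he)).ne'⟩
  exact det_toSquareBlock_monoidMatrix (Nat.mul_div_cancel' hdvd) w

theorem monoidMatrix_neg_left {N : ℕ} [NeZero N] {w : ZMod N → ℂ} (hw : w.Odd) (a b : ZMod N) :
    monoidMatrix w (-a) b = -monoidMatrix w a b := by
  simp only [monoidMatrix, Matrix.of_apply, ← Finset.sum_neg_distrib]
  rw [← Equiv.sum_comp (Equiv.neg (ZMod N))]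
  refine Finset.sum_congr rfl fun n _ => ?_
  simp only [Equiv.neg_apply, neg_mul_neg, hw n]
  split_ifs <;> simp

theorem monoidMatrix_neg_right {N : ℕ} [NeZero N] {w : ZMod N → ℂ} (hw : w.Odd) (a b : ZMod N) :
    monoidMatrix w a (-b) = -monoidMatrix w a b := by
  simp only [monoidMatrix, Matrix.of_apply, ← Finset.sum_neg_distrib]
  rw [← Equiv.sum_comp (Equiv.neg (ZMod N))]
  refine Finset.sum_congr rfl fun n _ => ?_
  simp only [Equiv.neg_apply, neg_mul, neg_inj, hw n]
  split_ifs <;> simp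

/-- The determinant of the odd part of `monoidMatrix w`, for odd `w`, in terms of the odd
Dirichlet characters. -/
theorem det_posMinor_monoidMatrix {N : ℕ} [NeZero N] {w : ZMod N → ℂ} (hw : w.Odd) :
    ((2 : ℂ) • posMinor (monoidMatrix w)).det = ∏ d ∈ N.divisors,
      ∏ χ : DirichletCharacter ℂ d,
        (∑ n, w n * χ ((n.val : ℕ) : ZMod d) + (1 + χ (-1)) / 2) := by
  rw [det_posMinor (monoidMatrix_neg_left hw) (monoidMatrix_neg_right hw)]
  have h1 : 1 - (1 / 2 : ℂ) • ((oddProj N).transpose * oddProj N) + monoidMatrix w =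
      monoidMatrix fun n =>
        w n + ((if n = 1 then 1 / 2 else 0) + if n = -1 then 1 / 2 else 0) := by
    ext a b
    have h2 (c : ZMod N) : (∑ n, if n * a = b then (if n = c then (1 / 2 : ℂ) else 0) else 0) =
        if c * a = b then 1 / 2 else 0 := by
      rw [Finset.sum_eq_single c]
      · simp
      · intro n _ hn
        simp [hn]
      · simp
    have h3 (p : Prop) [Decidable p] (x y z : ℂ) : (if p then x + (y + z) else 0) =
        (if p then x else 0) + ((if p then y else 0) + if p then z else 0) := by
      split_ifs <;> simp
    simp only [Matrix.add_apply, Matrix.sub_apply, Matrix.smul_apply,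
      transpose_oddProj_mul_oddProj_apply, monoidMatrix, Matrix.of_apply, h3,
      Finset.sum_add_distrib, h2, Matrix.one_apply, one_mul, neg_one_mul, neg_eq_iff_eq_neg,
      smul_eq_mul]
    split_ifs <;> ring
  rw [h1, det_monoidMatrix]
  refine Finset.prod_congr rfl fun d hd => Finset.prod_congr rfl fun χ _ => ?_
  have hdN := Nat.dvd_of_mem_divisors hd
  have hneg : (((-1 : ZMod N).val : ℕ) : ZMod d) = -1 := by
    rw [ZMod.natCast_val, ← ZMod.castHom_apply (h := hdN), map_neg, map_one]
  have hone : (((1 : ZMod N).val : ℕ) : ZMod d) = 1 := by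
    rw [ZMod.natCast_val, ← ZMod.castHom_apply (h := hdN), map_one]
  simp only [add_mul, ite_mul, zero_mul, Finset.sum_add_distrib, Finset.sum_ite_eq',
    Finset.mem_univ, if_true, hneg, hone, map_one]
  ring

/-- An odd function on `ZMod N` is orthogonal to the even Dirichlet characters. -/
theorem sum_mul_char_eq_zero {N d : ℕ} [NeZero N] (h : d ∣ N) {w : ZMod N → ℂ} (hw : w.Odd)
    {χ : DirichletCharacter ℂ d} (hχ : χ.Even) :
    ∑ n, w n * χ ((n.val : ℕ) : ZMod d) = 0 := by
  refine Function.Odd.sum_eq_zero fun n => ?_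
  simp only [ZMod.natCast_val, ← ZMod.castHom_apply (h := h), map_neg, hw n, hχ.eval_neg, neg_mul]

/-- The weight `w` with `∑ n, w n * Φ n = c * L(s, Φ)` for odd functions `Φ`. -/
noncomputable def hurwitzWeight (N : ℕ) [NeZero N] (c s : ℂ) (n : ZMod N) : ℂ :=
  c * ((N : ℂ) ^ (-s) * hurwitzZetaOdd (toAddCircle n) s)

theorem hurwitzWeight_odd (N : ℕ) [NeZero N] (c s : ℂ) : (hurwitzWeight N c s).Odd := fun n => by
  simp only [hurwitzWeight, map_neg, hurwitzZetaOdd_neg, mul_neg]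

theorem sum_hurwitzWeight_mul {N : ℕ} [NeZero N] (c s : ℂ) {Φ : ZMod N → ℂ} (hΦ : Φ.Odd) :
    ∑ n, hurwitzWeight N c s n * Φ n = c * LFunction Φ s := by
  rw [LFunction_def_odd hΦ, Finset.mul_sum, Finset.mul_sum]
  refine Finset.sum_congr rfl fun n _ => ?_
  rw [hurwitzWeight]
  ring

theorem sum_hurwitzWeight_mul_char {N d : ℕ} [NeZero N] [NeZero d] (h : d ∣ N) (c s : ℂ)
    {χ : DirichletCharacter ℂ d} (hχ : χ.Odd) :
    ∑ n, hurwitzWeight N c s n * χ ((n.val : ℕ) : ZMod d) =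
      c * DirichletCharacter.LFunction χ s := by
  have hodd : Function.Odd (χ : ZMod d → ℂ) := fun n => hχ.eval_neg χ n
  simp only [ZMod.natCast_val, ← ZMod.castHom_apply (h := h)]
  rw [sum_hurwitzWeight_mul c s fun n => by rw [map_neg, hodd], LFunction_comp_castHom h hodd]
  rfl

theorem det_posMinor_hurwitzWeight {N k : ℕ} [NeZero N] :
    ((2 : ℂ) • posMinor (monoidMatrix (hurwitzWeight N
      ((-1) ^ ((k + 1) / 2) * k.factorial / (2 * Real.pi) ^ k) k))).det =
      ∏ d ∈ N.divisors.filter (fun d => 2 < d), oddCharLProd k d := by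
  rw [det_posMinor_monoidMatrix (hurwitzWeight_odd N _ _), Finset.prod_filter]
  refine Finset.prod_congr rfl fun d hd => ?_
  have hdN := Nat.dvd_of_mem_divisors hd
  have hd0 := Nat.pos_of_mem_divisors hd
  have : NeZero d := ⟨hd0.ne'⟩
  have hodd (χ : DirichletCharacter ℂ d) (hχ : χ (-1) = -1) : 2 < d := by
    by_contra! hle
    have h1 : (-1 : ZMod d) = 1 := by interval_cases d <;> rfl
    rw [h1, map_one] at hχ
    norm_num at hχ
  have heven (χ : DirichletCharacter ℂ d) (hχ : χ (-1) ≠ -1) : χ.Even :=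
    χ.even_or_odd.resolve_right hχ
  split_ifs with h2
  · obtain ⟨n, rfl⟩ := Nat.exists_eq_succ_of_ne_zero hd0.ne'
    refine Finset.prod_congr rfl fun χ _ => ?_
    split_ifs with hχ
    · rw [sum_hurwitzWeight_mul_char hdN _ _ hχ, hχ]
      simp
    · rw [sum_mul_char_eq_zero hdN (hurwitzWeight_odd N _ _) (heven χ hχ), (heven χ hχ)]
      norm_num
  · refine Finset.prod_eq_one fun χ _ => ?_
    have hχ := heven χ fun h => h2 (hodd χ h)
    rw [sum_mul_char_eq_zero hdN (hurwitzWeight_odd N _ _) hχ, hχ]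
    norm_num

theorem map_bernoulliMatrixOdd {N k : ℕ} [NeZero N] (hko : Odd k) :
    (bernoulliMatrixOdd k N).map ((↑) : ℝ → ℂ) =
      (2 : ℂ) • posMinor (monoidMatrix (hurwitzWeight N
        ((-1) ^ ((k + 1) / 2) * k.factorial / (2 * Real.pi) ^ k) k) *
          Matrix.of fun a b => zmodSin N (a * b)) := by
  ext i j
  have hodd (x : ZMod N) : Function.Odd fun n => zmodSin N (x * n) := fun n => by
    simp only [mul_neg, zmodSin_neg]
  rw [Matrix.map_apply, Matrix.smul_apply, posMinor, Matrix.submatrix_apply, Matrix.mul_apply,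
    bernoulliMatrixOdd, Matrix.of_apply, periodicBernoulli_eq_sinZeta hko, mul_assoc,
    ← toAddCircle_natCast, ← LFunction_zmodSin, ← sum_hurwitzWeight_mul _ _ (hodd _), smul_eq_mul]
  congr 1
  simp only [monoidMatrix, Matrix.of_apply, Finset.sum_mul, ite_mul, zero_mul]
  rw [Finset.sum_comm]
  refine Finset.sum_congr rfl fun n _ => ?_
  simp only [Finset.sum_ite_eq, Finset.mem_univ, if_true]
  rw [posRep, posRep, show ((((i : ℕ) + 1) * ((j : ℕ) + 1) : ℕ) : ZMod N) * n =
    n * (((i : ℕ) + 1 : ℕ) : ZMod N) * (((j : ℕ) + 1 : ℕ) : ZMod N) by push_cast; ring]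

theorem map_bernoulliMatrixOdd_eq_mul {N k : ℕ} [NeZero N] (hko : Odd k) :
    (bernoulliMatrixOdd k N).map ((↑) : ℝ → ℂ) =
      (2 : ℂ) • (((2 : ℂ) • posMinor (monoidMatrix (hurwitzWeight N
        ((-1) ^ ((k + 1) / 2) * k.factorial / (2 * Real.pi) ^ k) k))) *
          (sinMatrix N).map (↑)) := by
  rw [map_bernoulliMatrixOdd hko, posMinor_mul
    (monoidMatrix_neg_left (hurwitzWeight_odd N _ _))
    (monoidMatrix_neg_right (hurwitzWeight_odd N _ _))
    (fun a b => by simp only [Matrix.of_apply, neg_mul, zmodSin_neg])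
    (fun a b => by simp only [Matrix.of_apply, mul_neg, zmodSin_neg]),
    posMinor_zmodSin, Matrix.smul_mul]

end Helpers

/-- For `N ≥ 2` and odd `k ≥ 1`,
`det(B_{k,N}) = (−1)^{N⁻(N⁻−1)/2} · N^{N⁻/2} ·
∏_{d ∣ N, d > 2} ∏_{χ odd mod d} ((−1)^{(k+1)/2}·k!/(2π)^k · L(k,χ))`. -/
theorem det_bernoulliMatrixOdd (N k : ℕ) (hN : 2 ≤ N) (hk : 1 ≤ k) (hko : Odd k) :
    ((bernoulliMatrixOdd k N).det : ℂ) =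
      (-1 : ℂ) ^ ((N - 1) / 2 * ((N - 1) / 2 - 1) / 2) *
        (Real.sqrt N : ℂ) ^ ((N - 1) / 2) *
        ∏ d ∈ N.divisors.filter (fun d => 2 < d), oddCharLProd k d := by
  have : NeZero N := ⟨by omega⟩
  have h1 : ((bernoulliMatrixOdd k N).det : ℂ) =
      ((bernoulliMatrixOdd k N).map ((↑) : ℝ → ℂ)).det := Complex.ofRealHom.map_det _
  have h2 : ((sinMatrix N).map ((↑) : ℝ → ℂ)).det = ((sinMatrix N).det : ℂ) :=
    (Complex.ofRealHom.map_det _).symm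
  rw [h1, map_bernoulliMatrixOdd_eq_mul hko, Matrix.det_smul, Matrix.det_mul, h2,
    det_posMinor_hurwitzWeight, det_sinMatrix, Fintype.card_fin]
  push_cast
  rw [div_pow]
  field_simp
end

section
/- Let n ≥ 1 be an integer and N = 2n+1. Then there exists an integer m such that det(T_{2,N}) = 4^{n+1−τ(N)} · m · N^{(n+1)/2}, i.e. the real number N^{−(n+1)/2}·det(T_{2,N}) is an integer divisible by 4^{n+1−τ(N)}. -/
/-- For `N = 2n+1`, the tangent matrix `T_{m,N} = (tan^m(πij/N))_{1 ≤ i,j ≤ n}`. -/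
noncomputable def tanMatrix (m n : ℕ) : Matrix (Fin n) (Fin n) ℝ :=
  Matrix.of fun i j =>
    Real.tan (Real.pi * ((i : ℕ) + 1) * ((j : ℕ) + 1) / (2 * n + 1)) ^ m

/-- For `N = 2n+1`, the weights `(-1)^r (N - 2r)` expressing `tan²` through cosines. -/
def tanWeight (n r : ℕ) : ℤ := (-1) ^ r * (2 * n + 1 - 2 * r)

/-- The representative in `{0, …, n}` of the class of `x` modulo `2n+1`, up to sign. -/
def foldMod (n : ℕ) (x : ZMod (2 * n + 1)) : ℕ := x.valMinAbs.natAbs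

/-- The integer matrix expressing the rows of `tanMatrix 2 n` through those of `cosMatrix n`. -/
def tanCoeff (n : ℕ) : Matrix (Fin n) (Fin n) ℤ :=
  Matrix.of fun i k => ∑ r : Fin n,
    if foldMod n (((i : ℕ) + 1 : ℕ) * ((r : ℕ) + 1 : ℕ)) = (k : ℕ) + 1 then
      tanWeight n ((r : ℕ) + 1) else 0

/-- The matrix `(2 cos(2πij/N) - 2)_{1 ≤ i,j ≤ n}` for `N = 2n+1`. -/
noncomputable def cosMatrix (n : ℕ) : Matrix (Fin n) (Fin n) ℝ :=
  Matrix.of fun i j =>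
    2 * Real.cos (2 * Real.pi * ((i : ℕ) + 1) * ((j : ℕ) + 1) / (2 * n + 1)) - 2

theorem four_mul_cos_sq_mul_sum (M θ : ℝ) (m : ℕ) :
    4 * Real.cos θ ^ 2 * ∑ r ∈ Finset.range m,
        (-1) ^ (r + 1) * (M - 2 * (r + 1)) * Real.cos (2 * (r + 1) * θ) =
      2 - M - M * Real.cos (2 * θ)
        + (-1) ^ m * ((M - 2 * (m + 1)) * Real.cos (2 * m * θ)
          + (M - 2 * m) * Real.cos (2 * (m + 1) * θ)) := by
  induction m with
  | zero => simp
  | succ m ih =>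
    rw [Finset.sum_range_succ, mul_add, ih]
    have h1 : Real.cos (2 * (m : ℝ) * θ) =
        Real.cos (2 * (m + 1) * θ) * Real.cos (2 * θ)
          + Real.sin (2 * (m + 1) * θ) * Real.sin (2 * θ) := by
      rw [← Real.cos_sub]; ring_nf
    have h2 : Real.cos (2 * ((m : ℝ) + 1 + 1) * θ) =
        Real.cos (2 * (m + 1) * θ) * Real.cos (2 * θ)
          - Real.sin (2 * (m + 1) * θ) * Real.sin (2 * θ) := by
      rw [← Real.cos_add]; ring_nf
    have h3 : Real.cos (2 * θ) = 2 * Real.cos θ ^ 2 - 1 := Real.cos_two_mul θ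
    push_cast
    rw [h1, h2, h3]
    ring

theorem tan_sq_eq_sum {n : ℕ} {θ : ℝ} (hs : Real.sin ((2 * n + 1) * θ) = 0)
    (hc : Real.cos θ ≠ 0) :
    Real.tan θ ^ 2 = ∑ r ∈ Finset.range n,
      (tanWeight n (r + 1) : ℝ) * (2 * Real.cos (2 * (r + 1) * θ) - 2) := by
  have h := four_mul_cos_sq_mul_sum (2 * n + 1) θ n
  have h0 := four_mul_cos_sq_mul_sum (2 * n + 1) 0 n
  have hp : Real.cos (2 * ((n : ℝ) + 1) * θ) = Real.cos (2 * n * θ) := by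
    have e1 : 2 * ((n : ℝ) + 1) * θ = (2 * n + 1) * θ + θ := by ring
    have e2 : 2 * (n : ℝ) * θ = (2 * n + 1) * θ - θ := by ring
    rw [e1, e2, Real.cos_add, Real.cos_sub, hs]
    ring
  have h3 : Real.cos (2 * θ) = 2 * Real.cos θ ^ 2 - 1 := Real.cos_two_mul θ
  have hsq := Real.sin_sq_add_cos_sq θ
  simp only [mul_zero, Real.cos_zero, mul_one, one_pow] at h0
  rw [hp, h3] at h
  have split : ∑ r ∈ Finset.range n,
      (tanWeight n (r + 1) : ℝ) * (2 * Real.cos (2 * (r + 1) * θ) - 2) =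
      2 * ∑ r ∈ Finset.range n,
        (-1) ^ (r + 1) * (2 * n + 1 - 2 * ((r : ℝ) + 1)) * Real.cos (2 * (r + 1) * θ)
      - 2 * ∑ r ∈ Finset.range n, (-1) ^ (r + 1) * (2 * n + 1 - 2 * ((r : ℝ) + 1)) := by
    rw [Finset.mul_sum, Finset.mul_sum, ← Finset.sum_sub_distrib]
    refine Finset.sum_congr rfl fun r _ => ?_
    simp only [tanWeight]
    push_cast
    ring
  rw [Real.tan_eq_sin_div_cos, div_pow, div_eq_iff (pow_ne_zero 2 hc), split]
  linear_combination hsq - h / 2 + h0 * Real.cos θ ^ 2 / 2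

theorem sum_two_mul_cos (n : ℕ) (m : ℤ) :
    ∑ k ∈ Finset.range n, 2 * Real.cos (2 * Real.pi * m * (k + 1) / (2 * n + 1)) =
      if (2 * n + 1 : ℤ) ∣ m then 2 * (n : ℝ) else -1 := by
  have hN : (2 * (n : ℝ) + 1) ≠ 0 := by positivity
  split_ifs with hd
  · obtain ⟨q, rfl⟩ := hd
    rw [Finset.sum_congr rfl (g := fun _ => (2 : ℝ))]
    · simp [mul_comm]
    · intro k _
      have : 2 * Real.pi * ((2 * n + 1) * q : ℤ) * ((k : ℝ) + 1) / (2 * n + 1) =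
          ((q * (k + 1) : ℤ) : ℝ) * (2 * Real.pi) := by
        push_cast
        field_simp
      rw [this, Real.cos_int_mul_two_pi]
      norm_num
  · set θ : ℝ := Real.pi * m / (2 * n + 1) with hθ
    have hs : Real.sin θ ≠ 0 := by
      intro h
      obtain ⟨q, hq⟩ := Real.sin_eq_zero_iff.mp h
      refine hd ⟨q, ?_⟩
      rw [hθ, eq_div_iff hN] at hq
      have : Real.pi * (((2 * n + 1) * q : ℤ) : ℝ) = Real.pi * m := by
        push_cast
        linarith
      exact_mod_cast (mul_left_cancel₀ Real.pi_ne_zero this).symm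
    have key (l : ℕ) : Real.sin θ * ∑ k ∈ Finset.range l, 2 * Real.cos (2 * (k + 1) * θ) =
        Real.sin ((2 * l + 1) * θ) - Real.sin θ := by
      induction l with
      | zero => simp
      | succ l ih =>
        rw [Finset.sum_range_succ, mul_add, ih]
        have e1 : (2 * (l : ℝ) + 1) * θ = 2 * (l + 1) * θ - θ := by ring
        have e2 : (2 * ((l + 1 : ℕ) : ℝ) + 1) * θ = 2 * (l + 1) * θ + θ := by
          push_cast
          ring
        rw [e1, e2, Real.sin_add, Real.sin_sub]
        ring
    have hk := key n
    have hz : Real.sin ((2 * n + 1) * θ) = 0 := by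
      rw [hθ, mul_div_cancel₀ _ hN, mul_comm]
      exact Real.sin_int_mul_pi m
    rw [hz] at hk
    refine mul_left_cancel₀ hs ?_
    rw [mul_neg_one, ← zero_sub, ← hk]
    refine congrArg _ (Finset.sum_congr rfl fun k _ => ?_)
    rw [hθ]
    congr 2
    ring

theorem cosMatrix_mul_self (n : ℕ) :
    cosMatrix n * cosMatrix n =
      (2 * n + 1 : ℝ) • (1 + Matrix.replicateCol Unit (fun _ => (2 : ℝ)) *
        Matrix.replicateRow Unit (fun _ => (1 : ℝ)) : Matrix (Fin n) (Fin n) ℝ) := by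
  ext i j
  have hexp (k : ℕ) :
      (2 * Real.cos (2 * Real.pi * ((i : ℕ) + 1) * (k + 1) / (2 * n + 1)) - 2) *
        (2 * Real.cos (2 * Real.pi * (k + 1) * ((j : ℕ) + 1) / (2 * n + 1)) - 2) =
      2 * Real.cos (2 * Real.pi * ((i + j + 2 : ℤ) : ℝ) * (k + 1) / (2 * n + 1))
      + 2 * Real.cos (2 * Real.pi * ((i - j : ℤ) : ℝ) * (k + 1) / (2 * n + 1))
      - (2 * Real.cos (2 * Real.pi * ((i + 1 : ℤ) : ℝ) * (k + 1) / (2 * n + 1))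
        + 2 * Real.cos (2 * Real.pi * ((i + 1 : ℤ) : ℝ) * (k + 1) / (2 * n + 1)))
      - (2 * Real.cos (2 * Real.pi * ((j + 1 : ℤ) : ℝ) * (k + 1) / (2 * n + 1))
        + 2 * Real.cos (2 * Real.pi * ((j + 1 : ℤ) : ℝ) * (k + 1) / (2 * n + 1))) + 4 := by
    have e1 : 2 * Real.pi * ((i + j + 2 : ℤ) : ℝ) * ((k : ℝ) + 1) / (2 * n + 1) =
        2 * Real.pi * ((i + 1 : ℤ) : ℝ) * (k + 1) / (2 * n + 1)
        + 2 * Real.pi * ((j + 1 : ℤ) : ℝ) * (k + 1) / (2 * n + 1) := by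
      push_cast
      ring
    have e2 : 2 * Real.pi * ((i - j : ℤ) : ℝ) * ((k : ℝ) + 1) / (2 * n + 1) =
        2 * Real.pi * ((i + 1 : ℤ) : ℝ) * (k + 1) / (2 * n + 1)
        - 2 * Real.pi * ((j + 1 : ℤ) : ℝ) * (k + 1) / (2 * n + 1) := by
      push_cast
      ring
    have e3 : 2 * Real.pi * ((k : ℝ) + 1) * ((j : ℕ) + 1) / (2 * n + 1) =
        2 * Real.pi * ((j + 1 : ℤ) : ℝ) * (k + 1) / (2 * n + 1) := by
      push_cast
      ring
    rw [e1, e2, e3, Real.cos_add, Real.cos_sub]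
    push_cast
    ring
  have hi := i.isLt
  have hj := j.isLt
  have d1 : ¬ (2 * n + 1 : ℤ) ∣ (i + j + 2 : ℤ) := fun h => by
    have := Int.le_of_dvd (by omega) h
    omega
  have d2 : ¬ (2 * n + 1 : ℤ) ∣ (i + 1 : ℤ) := fun h => by
    have := Int.le_of_dvd (by omega) h
    omega
  have d3 : ¬ (2 * n + 1 : ℤ) ∣ (j + 1 : ℤ) := fun h => by
    have := Int.le_of_dvd (by omega) h
    omega
  have d4 : (2 * n + 1 : ℤ) ∣ (i - j : ℤ) ↔ i = j := by
    constructor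
    · intro h
      have := Int.eq_zero_of_abs_lt_dvd h (by rw [abs_lt]; omega)
      exact Fin.ext (by omega)
    · rintro rfl
      simp
  simp only [Matrix.mul_apply, cosMatrix, Matrix.of_apply]
  rw [Fin.sum_univ_eq_sum_range (fun k =>
    (2 * Real.cos (2 * Real.pi * ((i : ℕ) + 1) * (k + 1) / (2 * n + 1)) - 2) *
      (2 * Real.cos (2 * Real.pi * (k + 1) * ((j : ℕ) + 1) / (2 * n + 1)) - 2)) n]
  simp only [hexp, Finset.sum_add_distrib, Finset.sum_sub_distrib]
  simp only [sum_two_mul_cos, if_neg d1, if_neg d2, if_neg d3, d4]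
  rw [Matrix.smul_apply, Matrix.add_apply, Matrix.one_apply, Matrix.mul_apply]
  split_ifs <;> simp <;> ring

theorem det_cosMatrix_sq (n : ℕ) :
    (cosMatrix n).det ^ 2 = (Real.sqrt (2 * n + 1) ^ (n + 1)) ^ 2 := by
  rw [← pow_mul, mul_comm (n + 1), pow_mul, Real.sq_sqrt (by positivity), sq, ← Matrix.det_mul,
    cosMatrix_mul_self, Matrix.det_smul, Matrix.det_one_add_replicateCol_mul_replicateRow]
  simp only [dotProduct, one_mul, Finset.sum_const, Finset.card_univ, Fintype.card_fin,
    nsmul_eq_mul, pow_succ]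
  ring

theorem cos_foldMod (n : ℕ) (x j : ℕ) :
    Real.cos (2 * Real.pi * (foldMod n x : ℝ) * j / (2 * n + 1)) =
      Real.cos (2 * Real.pi * x * j / (2 * n + 1)) := by
  have hN : (2 * (n : ℝ) + 1) ≠ 0 := by positivity
  set v : ℤ := (x : ZMod (2 * n + 1)).valMinAbs with hv
  have hz : ((v - x : ℤ) : ZMod (2 * n + 1)) = 0 := by
    push_cast
    rw [hv, ZMod.coe_valMinAbs, sub_self]
  obtain ⟨q, hq⟩ := (ZMod.intCast_zmod_eq_zero_iff_dvd _ _).mp hz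
  have hq' : (v : ℝ) = x + (2 * n + 1) * q := by
    have : ((v - x : ℤ) : ℝ) = ((((2 * n + 1 : ℕ) : ℤ) * q : ℤ) : ℝ) := by rw [hq]
    push_cast at this
    linarith
  have hf : (foldMod n x : ℝ) = |(v : ℝ)| := by
    rw [foldMod, ← hv, Nat.cast_natAbs, Int.cast_abs]
  have hpos : 2 * Real.pi * |(v : ℝ)| * j / (2 * n + 1) =
      |2 * Real.pi * v * j / (2 * n + 1)| := by
    have hd : (0 : ℝ) < 2 * n + 1 := by positivity
    rw [abs_div, abs_mul, abs_mul, abs_of_pos hd, abs_of_pos Real.two_pi_pos, Nat.abs_cast]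
  rw [hf, hpos, Real.cos_abs, hq']
  have : 2 * Real.pi * (x + (2 * n + 1) * q) * j / (2 * n + 1) =
      2 * Real.pi * x * j / (2 * n + 1) + ((q * j : ℤ) : ℝ) * (2 * Real.pi) := by
    push_cast
    field_simp
  rw [this, Real.cos_add_int_mul_two_pi]

theorem foldMod_le (n : ℕ) (x : ZMod (2 * n + 1)) : foldMod n x ≤ n := by
  have := ZMod.natAbs_valMinAbs_le x
  unfold foldMod
  omega

theorem sum_ite_foldMod {R : Type*} [AddCommMonoid R] {n m : ℕ} (hm : m ≤ n) (g : ℕ → R)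
    (g0 : g 0 = 0) :
    ∑ k : Fin n, (if m = (k : ℕ) + 1 then g ((k : ℕ) + 1) else 0) = g m := by
  rcases m with _ | m
  · rw [g0]
    exact Finset.sum_eq_zero fun k _ => if_neg (by omega)
  · rw [Finset.sum_eq_single (⟨m, hm⟩ : Fin n)]
    · simp
    · intro k _ hk
      exact if_neg fun h => hk (Fin.ext (by simpa using (Nat.succ_injective h).symm))
    · simp

theorem tanMatrix_two_eq (n : ℕ) :
    tanMatrix 2 n = (tanCoeff n).map (Int.cast : ℤ → ℝ) * cosMatrix n := by
  ext i j
  have hN : (2 * (n : ℝ) + 1) ≠ 0 := by positivity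
  have h1 : (2 * (n : ℝ) + 1) * (Real.pi * ((i : ℕ) + 1) * ((j : ℕ) + 1) / (2 * n + 1)) =
      (((i + 1) * (j + 1) : ℤ) : ℝ) * Real.pi := by
    push_cast
    field_simp
  have hc : Real.cos (Real.pi * ((i : ℕ) + 1) * ((j : ℕ) + 1) / (2 * n + 1)) ≠ 0 := by
    intro h
    obtain ⟨q, hq⟩ := Real.cos_eq_zero_iff.mp h
    rw [hq] at h1
    have h2 : Real.pi * (((2 * n + 1) * (2 * q + 1) : ℤ) : ℝ) =
        Real.pi * ((2 * ((i + 1) * (j + 1)) : ℤ) : ℝ) := by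
      push_cast at h1 ⊢
      linarith
    have h3 := mul_left_cancel₀ Real.pi_ne_zero h2
    have h4 : (2 * (n : ℤ) + 1) * (2 * q + 1) = 2 * ((i + 1) * (j + 1)) := by exact_mod_cast h3
    have h5 : Odd ((2 * (n : ℤ) + 1) * (2 * q + 1)) :=
      (odd_two_mul_add_one _).mul (odd_two_mul_add_one _)
    rw [h4] at h5
    exact (Int.not_even_iff_odd.mpr h5) (even_two_mul _)
  simp only [tanMatrix, Matrix.of_apply]
  rw [tan_sq_eq_sum (n := n) (by rw [h1]; exact Real.sin_int_mul_pi _) hc]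
  simp only [Matrix.mul_apply, Matrix.map_apply, tanCoeff, cosMatrix, Matrix.of_apply]
  push_cast
  simp only [Finset.sum_mul]
  rw [Finset.sum_comm, ← Fin.sum_univ_eq_sum_range (fun r => (tanWeight n (r + 1) : ℝ) *
    (2 * Real.cos (2 * (r + 1) *
      (Real.pi * ((i : ℕ) + 1) * ((j : ℕ) + 1) / (2 * n + 1))) - 2)) n]
  refine Finset.sum_congr rfl fun r _ => ?_
  have hs := sum_ite_foldMod (foldMod_le n (((i : ℕ) + 1 : ℕ) * ((r : ℕ) + 1 : ℕ)))
    (fun k => (tanWeight n (r + 1) : ℝ) *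
      (2 * Real.cos (2 * Real.pi * k * ((j : ℕ) + 1 : ℕ) / (2 * n + 1)) - 2)) (by simp)
  have hf := cos_foldMod n ((i + 1) * (r + 1)) (j + 1)
  push_cast at hs hf ⊢
  rw [hf] at hs
  simp only [ite_mul, zero_mul]
  rw [hs]
  congr 4
  ring

theorem four_dvd_tanWeight_sub (n r : ℕ) : (4 : ℤ) ∣ tanWeight n r - (2 * n + 1) := by
  unfold tanWeight
  rcases Nat.even_or_odd r with h | h
  · rw [h.neg_one_pow]
    obtain ⟨s, rfl⟩ := h
    exact ⟨-s, by push_cast; ring⟩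
  · rw [h.neg_one_pow]
    obtain ⟨s, rfl⟩ := h
    exact ⟨s - n, by push_cast; ring⟩

theorem foldMod_eq_iff {n : ℕ} {x y : ZMod (2 * n + 1)} :
    foldMod n x = foldMod n y ↔ x = y ∨ x = -y :=
  ZMod.natAbs_valMinAbs_eq_natAbs_valMinAbs

theorem foldMod_natCast {n m : ℕ} (hm : m ≤ n) : foldMod n m = m := by
  rw [foldMod, ZMod.valMinAbs_natCast_of_le_half (by omega), Int.natAbs_natCast]

theorem cast_foldMod (n : ℕ) (x : ZMod (2 * n + 1)) :
    (foldMod n x : ZMod (2 * n + 1)) = x ∨ (foldMod n x : ZMod (2 * n + 1)) = -x :=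
  foldMod_eq_iff.mp (foldMod_natCast (foldMod_le n x))

theorem foldMod_eq_zero_iff {n : ℕ} {x : ZMod (2 * n + 1)} : foldMod n x = 0 ↔ x = 0 := by
  rw [foldMod, Int.natAbs_eq_zero, ZMod.valMinAbs_eq_zero]

theorem succ_cast_ne_zero {n : ℕ} (r : Fin n) : (((r : ℕ) + 1 : ℕ) : ZMod (2 * n + 1)) ≠ 0 := by
  rw [← foldMod_eq_zero_iff.ne, foldMod_natCast (by omega)]
  omega

/-- Multiplication by a unit of `ZMod (2n+1)`, up to sign, on representatives `1, …, n`. -/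
def unitFold (n : ℕ) (u : (ZMod (2 * n + 1))ˣ) (r : Fin n) : Fin n :=
  ⟨foldMod n (u * ((r : ℕ) + 1 : ℕ)) - 1, by
    have := foldMod_le n (u * ((r : ℕ) + 1 : ℕ))
    have := r.isLt
    omega⟩

theorem unitFold_add_one {n : ℕ} (u : (ZMod (2 * n + 1))ˣ) (r : Fin n) :
    (unitFold n u r : ℕ) + 1 = foldMod n (u * ((r : ℕ) + 1 : ℕ)) := by
  have : foldMod n (u * ((r : ℕ) + 1 : ℕ)) ≠ 0 :=
    foldMod_eq_zero_iff.ne.mpr fun h => succ_cast_ne_zero r (u.mul_right_eq_zero.mp h)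
  simp only [unitFold]
  omega

theorem unitFold_bijective {n : ℕ} (u : (ZMod (2 * n + 1))ˣ) :
    Function.Bijective (unitFold n u) := by
  refine Finite.injective_iff_bijective.mp fun r s h => ?_
  have h1 : foldMod n (u * ((r : ℕ) + 1 : ℕ)) = foldMod n (u * ((s : ℕ) + 1 : ℕ)) := by
    rw [← unitFold_add_one, ← unitFold_add_one, h]
  rw [foldMod_eq_iff, ← mul_neg, u.mul_right_inj, u.mul_right_inj, ← foldMod_eq_iff,
    foldMod_natCast (by omega), foldMod_natCast (by omega)] at h1
  exact Fin.ext (by omega)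

theorem sum_foldMod_unit_mul {R : Type*} [AddCommMonoid R] {n : ℕ} (u : (ZMod (2 * n + 1))ˣ)
    (a : ZMod (2 * n + 1)) (g : ℕ → R) :
    ∑ r : Fin n, g (foldMod n (u * a * ((r : ℕ) + 1 : ℕ))) =
      ∑ r : Fin n, g (foldMod n (a * ((r : ℕ) + 1 : ℕ))) := by
  refine Fintype.sum_bijective (unitFold n u) (unitFold_bijective u) _ _ fun r => congrArg g ?_
  rw [unitFold_add_one, foldMod_eq_iff]
  rcases cast_foldMod n (u * ((r : ℕ) + 1 : ℕ)) with h | h <;> rw [h]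
  · left
    ring
  · right
    ring

theorem exists_unit_mul_gcd {N : ℕ} [NeZero N] (i : ℕ) :
    ∃ u : (ZMod N)ˣ, (i : ZMod N) = u * (i.gcd N : ℕ) := by
  obtain ⟨d, hd, _, ⟨u, rfl⟩, h⟩ := ZMod.eq_unit_mul_divisor (i : ZMod N)
  have hmod : i ≡ (u : ZMod N).val * d [MOD N] := by
    rw [← ZMod.natCast_eq_natCast_iff, h, Nat.cast_mul, ZMod.natCast_zmod_val]
  have hgcd : i.gcd N = d := by
    rw [hmod.gcd_eq, (ZMod.val_coe_unit_coprime u).gcd_mul_left_cancel, Nat.gcd_eq_left hd]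
  exact ⟨u, by rw [hgcd, h]⟩

/-- The index of the divisor `gcd(i, 2n+1)`. -/
def gcdIndex (n : ℕ) (i : Fin n) : Fin n :=
  ⟨((i : ℕ) + 1).gcd (2 * n + 1) - 1, by
    have := Nat.gcd_le_left (2 * n + 1) (Nat.add_one_pos (i : ℕ))
    omega⟩

theorem gcdIndex_add_one {n : ℕ} (i : Fin n) :
    (gcdIndex n i : ℕ) + 1 = ((i : ℕ) + 1).gcd (2 * n + 1) :=
  Nat.sub_add_cancel (Nat.gcd_pos_of_pos_left _ (Nat.succ_pos _))

theorem gcdIndex_le {n : ℕ} (i : Fin n) : gcdIndex n i ≤ i := by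
  have := Nat.gcd_le_left (2 * n + 1) (Nat.add_one_pos (i : ℕ))
  have := gcdIndex_add_one i
  exact Fin.le_def.mpr (by omega)

theorem four_dvd_tanCoeff_sub (n : ℕ) (i k : Fin n) :
    (4 : ℤ) ∣ tanCoeff n i k - tanCoeff n (gcdIndex n i) k := by
  have h (i : Fin n) : (4 : ℤ) ∣ tanCoeff n i k - ∑ r : Fin n,
      if foldMod n (((i : ℕ) + 1 : ℕ) * ((r : ℕ) + 1 : ℕ)) = (k : ℕ) + 1 then
        (2 * n + 1 : ℤ) else 0 := by
    rw [tanCoeff, Matrix.of_apply, ← Finset.sum_sub_distrib]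
    refine Finset.dvd_sum fun r _ => ?_
    split_ifs
    · exact four_dvd_tanWeight_sub n _
    · simp
  obtain ⟨u, hu⟩ := exists_unit_mul_gcd (N := 2 * n + 1) ((i : ℕ) + 1)
  have h1 := h i
  have h2 := h (gcdIndex n i)
  rw [hu, sum_foldMod_unit_mul u _ fun m => if m = (k : ℕ) + 1 then (2 * n + 1 : ℤ) else 0,
    ← gcdIndex_add_one] at h1
  simpa using dvd_sub h1 h2

theorem pow_card_dvd_det {ι R : Type*} [Fintype ι] [LinearOrder ι] [CommRing R]
    (A : Matrix ι ι R) (ρ : ι → ι) (hρ : ∀ i, ρ i ≤ i) (c : R)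
    (h : ∀ i j, c ∣ A i j - A (ρ i) j) :
    c ^ (Finset.univ.filter fun i => ρ i ≠ i).card ∣ A.det := by
  choose B hB using h
  let L : Matrix ι ι R := 1 - Matrix.of fun i j => if ρ i ≠ i ∧ ρ i = j then 1 else 0
  have hL : L.det = 1 := by
    rw [Matrix.det_of_isLowerTriangular]
    · refine Finset.prod_eq_one fun i _ => ?_
      simp [L]
    · intro i j hij
      have hij : i < j := hij
      have h1 : ρ i ≠ j := ((hρ i).trans_lt hij).ne
      simp [L, hij.ne, h1]
  have hLA : L * A = Matrix.of fun i j =>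
      (if ρ i ≠ i then c else 1) * (if ρ i ≠ i then B i j else A i j) := by
    ext i j
    have hsum : (L * A) i j = A i j - if ρ i ≠ i then A (ρ i) j else 0 := by
      rw [Matrix.sub_mul, one_mul, Matrix.sub_apply, Matrix.mul_apply]
      by_cases hi : ρ i = i <;> simp [hi]
    rw [hsum, Matrix.of_apply]
    split_ifs
    · exact hB i j
    · simp
  rw [← one_mul A.det, ← hL, ← Matrix.det_mul, hLA]
  have hprod : ∏ i, (if ρ i ≠ i then c else 1) =
      c ^ (Finset.univ.filter fun i => ρ i ≠ i).card := by
    rw [Finset.prod_ite]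
    simp
  rw [← hprod]
  exact Dvd.intro _ (Matrix.det_mul_column (fun i => if ρ i ≠ i then c else 1)
    (Matrix.of fun i j => if ρ i ≠ i then B i j else A i j)).symm

theorem card_gcdIndex_ne (n : ℕ) :
    (Finset.univ.filter fun i => gcdIndex n i ≠ i).card =
      n + 1 - (2 * n + 1).divisors.card := by
  have h1 : (Finset.univ.filter fun i => gcdIndex n i = i).card =
      (2 * n + 1).properDivisors.card := by
    refine Finset.card_bij (fun i _ => (i : ℕ) + 1) ?_ ?_ ?_
    · intro i hi
      rw [Finset.mem_filter_univ] at hi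
      rw [Nat.mem_properDivisors]
      have := gcdIndex_add_one i
      rw [hi] at this
      exact ⟨Nat.gcd_eq_left_iff_dvd.mp this.symm, by omega⟩
    · intro i _ j _ hij
      exact Fin.ext (by omega)
    · intro d hd
      obtain ⟨⟨e, he⟩, hlt⟩ := Nat.mem_properDivisors.mp hd
      have hd0 : d ≠ 0 := by
        rintro rfl
        omega
      have hdn : d ≤ n := by
        rcases e with _ | _ | e
        · omega
        · omega
        · nlinarith
      refine ⟨⟨d - 1, by omega⟩, ?_, Nat.sub_add_cancel (by omega)⟩
      rw [Finset.mem_filter_univ]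
      refine Fin.ext (Nat.succ_injective ?_)
      have := gcdIndex_add_one (n := n) ⟨d - 1, by omega⟩
      simp only [Nat.sub_add_cancel (Nat.one_le_iff_ne_zero.mpr hd0)] at this
      rw [Nat.gcd_eq_left ⟨e, he⟩] at this
      simp only [Nat.succ_eq_add_one, this]
      omega
  have h2 := Finset.card_filter_add_card_filter_not (s := (Finset.univ : Finset (Fin n)))
    (fun i => gcdIndex n i = i)
  have h3 : (2 * n + 1).divisors.card = (2 * n + 1).properDivisors.card + 1 := by
    rw [← Nat.insert_self_properDivisors (by omega),
      Finset.card_insert_of_notMem Nat.self_notMem_properDivisors]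
  rw [Finset.card_univ, Fintype.card_fin] at h2
  simp only [ne_eq]
  omega

/-- For `n ≥ 1` and `N = 2n+1`, the real number `N^{−(n+1)/2}·det(T_{2,N})` is an
integer divisible by `4^{n+1−τ(N)}`, where `τ(N)` is the number of positive divisors
of `N`: there is an integer `m` with `det(T_{2,N}) = 4^{n+1−τ(N)} · m · N^{(n+1)/2}`. -/
theorem det_tanMatrix_two (n : ℕ) (hn : 1 ≤ n) :
    ∃ m : ℤ, (tanMatrix 2 n).det =
      4 ^ (n + 1 - (2 * n + 1).divisors.card) * (m : ℝ) *
        Real.sqrt (2 * n + 1) ^ (n + 1) := by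
  obtain ⟨m, hm⟩ := pow_card_dvd_det (tanCoeff n) (gcdIndex n) gcdIndex_le 4
    (four_dvd_tanCoeff_sub n)
  rw [card_gcdIndex_ne] at hm
  have hdet : (tanMatrix 2 n).det =
      4 ^ (n + 1 - (2 * n + 1).divisors.card) * (m : ℝ) * (cosMatrix n).det := by
    rw [tanMatrix_two_eq, Matrix.det_mul, ← Int.cast_det, hm]
    push_cast
    rfl
  rcases sq_eq_sq_iff_eq_or_eq_neg.mp (det_cosMatrix_sq n) with h | h
  · exact ⟨m, by rw [hdet, h]⟩
  · refine ⟨-m, ?_⟩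
    rw [hdet, h]
    push_cast
    ring
end
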